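/- Let V be a 6-dimensional real vector space with a fixed volume form identification, and define K(φ) ∈ End(V) by ι_{K(φ)v} vol = −ι_v φ ∧ φ. Then for φ = e¹²³ + e⁴⁵⁶ (with vol = e¹²³⁴⁵⁶), K(φ)² is a positive multiple of the identity; in fact K(φ)² = id. -/

import Mathlib

noncomputable section

/-- The model 6-dimensional real vector space. -/
abbrev V6 := Fin 6 → ℝ

/-- Alternating k-forms on V6. -/
abbrev Form (k : ℕ) := AlternatingMap ℝ V6 ℝ (Fin k)

/-- Wedge product of alternating forms (determinant convention). -/
noncomputable def wedge {a b : ℕ} (φ : Form a) (ψ : Form b) : Form (a + b) :=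
  AlternatingMap.domDomCongr finSumFinEquiv
    ((TensorProduct.lid ℝ ℝ).toLinearMap.compAlternatingMap (AlternatingMap.domCoprod φ ψ))

infixl:70 " ⋏ " => wedge

/-- Interior product (contraction) of a form with a vector. -/
noncomputable def iota (v : V6) {k : ℕ} (φ : Form (k + 1)) : Form k :=
  AlternatingMap.curryLeft φ v

/-- The standard dual basis 1-forms e¹, …, e⁶ (0-indexed). -/
noncomputable def e (i : Fin 6) : Form 1 :=
  AlternatingMap.ofSubsingleton ℝ V6 ℝ 0 (LinearMap.proj i)

/-- The standard basis vectors e₁, …, e₆ (0-indexed). -/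
def b (i : Fin 6) : V6 := Pi.single i 1

/-- The standard volume form e¹∧e²∧e³∧e⁴∧e⁵∧e⁶. -/
noncomputable def vol : Form 6 := e 0 ⋏ e 1 ⋏ e 2 ⋏ e 3 ⋏ e 4 ⋏ e 5

/-- The monomial form `e^{l 0} ∧ ⋯ ∧ e^{l (k - 1)}`, as an alternatized product of coordinates. -/
def mono {k : ℕ} (l : Fin k → Fin 6) : Form k :=
  MultilinearMap.alternatization
    ((MultilinearMap.mkPiAlgebra ℝ (Fin k) ℝ).compLinearMap fun i => LinearMap.proj (l i))

theorem mono_apply {k : ℕ} (l : Fin k → Fin 6) (v : Fin k → V6) :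
    mono l v = (Matrix.of fun i j => v i (l j)).det := by
  rw [mono, MultilinearMap.alternatization_apply, Matrix.det_apply]
  simp

theorem e_eq_mono (i : Fin 6) : e i = mono ![i] := by
  ext v
  simp [mono_apply, e]

theorem wedge_add_left {a b : ℕ} (φ φ' : Form a) (ψ : Form b) :
    (φ + φ') ⋏ ψ = φ ⋏ ψ + φ' ⋏ ψ := by
  simp only [wedge, ← AlternatingMap.domCoprod'_apply, TensorProduct.add_tmul, map_add]
  ext v
  simp

theorem wedge_smul_left {a b : ℕ} (c : ℝ) (φ : Form a) (ψ : Form b) :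
    (c • φ) ⋏ ψ = c • (φ ⋏ ψ) := by
  simp only [wedge, ← AlternatingMap.domCoprod'_apply, ← TensorProduct.smul_tmul', map_smul]
  ext v
  simp

theorem wedge_add_right {a b : ℕ} (φ : Form a) (ψ ψ' : Form b) :
    φ ⋏ (ψ + ψ') = φ ⋏ ψ + φ ⋏ ψ' := by
  simp only [wedge, ← AlternatingMap.domCoprod'_apply, TensorProduct.tmul_add, map_add]
  ext v
  simp

theorem mono_wedge_mono {a b : ℕ} (l : Fin a → Fin 6) (m : Fin b → Fin 6) :
    mono l ⋏ mono m = mono (Fin.append l m) := by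
  ext v
  rw [wedge, mono, mono, ← MultilinearMap.domCoprod_alternization, mono,
    MultilinearMap.alternatization_apply, AlternatingMap.domDomCongr_apply,
    LinearMap.compAlternatingMap_apply, MultilinearMap.alternatization_apply, map_sum,
    ← finSumFinEquiv.permCongr.sum_comp]
  refine Finset.sum_congr rfl fun σ _ => ?_
  rw [Units.smul_def, map_zsmul]
  simp [Fin.prod_univ_add, Units.smul_def]

theorem mono_eq_zero {k : ℕ} {l : Fin k → Fin 6} {i j : Fin k} (hij : i ≠ j) (h : l i = l j) :
    mono l = 0 := by
  ext v
  rw [mono_apply]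
  exact Matrix.det_zero_of_column_eq hij fun r => by simp [h]

theorem mono_comp_perm {k : ℕ} (l : Fin k → Fin 6) (σ : Equiv.Perm (Fin k)) :
    mono (l ∘ σ) = ((Equiv.Perm.sign σ : ℤ) : ℝ) • mono l := by
  ext v
  rw [AlternatingMap.smul_apply, mono_apply, mono_apply, smul_eq_mul, ← Matrix.det_permute']
  rfl

theorem iota_add (v : V6) {k : ℕ} (φ ψ : Form (k + 1)) :
    iota v (φ + ψ) = iota v φ + iota v ψ := rfl

theorem Form.sum_apply {ι : Type*} {k : ℕ} (s : Finset ι) (f : ι → Form k) (w : Fin k → V6) :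
    (∑ i ∈ s, f i) w = ∑ i ∈ s, f i w :=
  map_sum (⟨⟨fun φ => φ w, rfl⟩, fun _ _ => rfl⟩ : Form k →+ ℝ) f s

theorem iota_mono (v : V6) {k : ℕ} (l : Fin (k + 1) → Fin 6) :
    iota v (mono l) =
      ∑ j : Fin (k + 1), ((-1 : ℝ) ^ (j : ℕ) * v (l j)) • mono (l ∘ j.succAbove) := by
  ext w
  rw [Form.sum_apply]
  simp only [iota, AlternatingMap.curryLeft_apply_apply, AlternatingMap.smul_apply, mono_apply,
    Matrix.det_succ_row_zero, smul_eq_mul]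
  rfl

theorem vol_eq_mono : vol = mono id := by
  simp only [vol, e_eq_mono, mono_wedge_mono]
  exact congrArg mono (by decide)

theorem vol_update_b (u : V6) (i : Fin 6) : vol (Function.update b i u) = u i := by
  have hb : (Matrix.of fun r c => Function.update b i u r (id c)) =
      (1 : Matrix (Fin 6) (Fin 6) ℝ).updateRow i u := by
    ext r c
    by_cases hr : r = i
    · subst hr; simp
    · simp [hr, b, Matrix.one_apply, Pi.single_apply, eq_comm]
  rw [vol_eq_mono, mono_apply, hb, ← Matrix.cramer_transpose_apply]
  simp

theorem iota_vol_tail_swap (u : V6) (i : Fin 6) :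
    iota u vol (Fin.tail (b ∘ Equiv.swap 0 i)) = Equiv.Perm.sign (Equiv.swap 0 i) • u i := by
  have hu : Matrix.vecCons u (Fin.tail (b ∘ Equiv.swap 0 i)) =
      Function.update b i u ∘ Equiv.swap 0 i := by
    rw [Function.update_comp_equiv, Equiv.symm_swap, Equiv.swap_apply_right]
    funext j
    cases j using Fin.cases <;> simp [Fin.tail]
  rw [iota, AlternatingMap.curryLeft_apply_apply, hu, AlternatingMap.map_perm, vol_update_b]

theorem iota_vol_injective : Function.Injective fun v : V6 => iota v vol := by
  intro v w h
  funext i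
  have hi := DFunLike.congr_fun h (Fin.tail (b ∘ Equiv.swap 0 i))
  simpa only [iota_vol_tail_swap, smul_left_cancel_iff] using hi

theorem iota_mono_three (v : V6) (x y z : Fin 6) :
    iota v (mono ![x, y, z]) =
      v x • mono ![y, z] + (-v y) • mono ![x, z] + v z • mono ![x, y] := by
  have h₀ : ![x, y, z] ∘ Fin.succAbove 0 = ![y, z] := by
    funext i; fin_cases i <;> rfl
  have h₁ : ![x, y, z] ∘ Fin.succAbove 1 = ![x, z] := by
    funext i; fin_cases i <;> rfl
  have h₂ : ![x, y, z] ∘ Fin.succAbove 2 = ![x, y] := by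
    funext i; fin_cases i <;> rfl
  rw [iota_mono, Fin.sum_univ_three, h₀, h₁, h₂]
  simp

theorem mono_two_wedge_mono_three (x y p q r : Fin 6) :
    mono ![x, y] ⋏ mono ![p, q, r] = mono ![x, y, p, q, r] := by
  have h : Fin.append ![x, y] ![p, q, r] = ![x, y, p, q, r] := by
    funext i; fin_cases i <;> rfl
  rw [mono_wedge_mono, h]

theorem mono_two_wedge_mono_three_comm (x y p q r : Fin 6) :
    mono ![x, y] ⋏ mono ![p, q, r] = mono ![p, q, r, x, y] := by
  have h : ![x, y, p, q, r] = ![p, q, r, x, y] ∘ ⇑(finRotate 5 ^ 3) := by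
    funext i; fin_cases i <;> rfl
  have hs : Equiv.Perm.sign (finRotate 5 ^ 3) = 1 := by decide
  rw [mono_two_wedge_mono_three, h, mono_comp_perm, hs]
  simp

theorem iota_vol (u : V6) : iota u vol =
    u 0 • mono ![1, 2, 3, 4, 5] - u 1 • mono ![0, 2, 3, 4, 5] + u 2 • mono ![0, 1, 3, 4, 5]
      - u 3 • mono ![0, 1, 2, 4, 5] + u 4 • mono ![0, 1, 2, 3, 5]
      - u 5 • mono ![0, 1, 2, 3, 4] := by
  have h₀ : Fin.succAbove (0 : Fin 6) = ![1, 2, 3, 4, 5] := by decide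
  have h₁ : Fin.succAbove (1 : Fin 6) = ![0, 2, 3, 4, 5] := by decide
  have h₂ : Fin.succAbove (2 : Fin 6) = ![0, 1, 3, 4, 5] := by decide
  have h₃ : Fin.succAbove (3 : Fin 6) = ![0, 1, 2, 4, 5] := by decide
  have h₄ : Fin.succAbove (4 : Fin 6) = ![0, 1, 2, 3, 5] := by decide
  have h₅ : Fin.succAbove (5 : Fin 6) = ![0, 1, 2, 3, 4] := by decide
  rw [vol_eq_mono, iota_mono, Fin.sum_univ_six]
  simp only [Function.id_comp, id, h₀, h₁, h₂, h₃, h₄, h₅]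
  norm_num
  module

theorem neg_iota_wedge_eq_iota_vol (v : V6) :
    -(iota v (mono ![0, 1, 2] + mono ![3, 4, 5]) ⋏ (mono ![0, 1, 2] + mono ![3, 4, 5])) =
      iota ![-v 0, -v 1, -v 2, v 3, v 4, v 5] vol := by
  have hz (l : Fin 5 → Fin 6) (h : ∃ i j, i ≠ j ∧ l i = l j) : mono l = 0 := by
    obtain ⟨i, j, hij, h⟩ := h
    exact mono_eq_zero hij h
  simp only [iota_vol, iota_add, iota_mono_three, wedge_add_left, wedge_add_right,
    wedge_smul_left, mono_two_wedge_mono_three_comm _ _ 0 1 2, mono_two_wedge_mono_three _ _ 3 4 5]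
  simp (disch := decide) only [hz]
  simp
  module

/-- For φ = e¹²³ + e⁴⁵⁶ with vol = e¹²³⁴⁵⁶, any K with ι_{K v} vol = −ι_v φ ∧ φ
satisfies: K² is a positive multiple of the identity; in fact K² = id. -/
theorem Ksquare_Oplus (φ : Form 3) (hφ : φ = e 0 ⋏ e 1 ⋏ e 2 + e 3 ⋏ e 4 ⋏ e 5)
    (K : V6 →ₗ[ℝ] V6) (hK : ∀ v : V6, iota (K v) vol = -(iota v φ ⋏ φ)) :
    (∃ c : ℝ, 0 < c ∧ K ∘ₗ K = c • LinearMap.id) ∧ K ∘ₗ K = LinearMap.id := by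
  have hφ' : φ = mono ![0, 1, 2] + mono ![3, 4, 5] := by
    simp only [hφ, e_eq_mono, mono_wedge_mono]
    exact congrArg₂ (fun l m => mono l + mono m) (by decide) (by decide)
  have hKv (v : V6) : K v = ![-v 0, -v 1, -v 2, v 3, v 4, v 5] :=
    iota_vol_injective <| by simp only [hK, hφ', neg_iota_wedge_eq_iota_vol]
  have hKK : K ∘ₗ K = LinearMap.id := by
    refine LinearMap.ext fun v => ?_
    ext i
    fin_cases i <;> simp [hKv]
  exact ⟨⟨1, one_pos, by rw [hKK, one_smul]⟩, hKK⟩
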